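/- arXiv:1509.08484 — 2 statements merged into one kernel-verified Lean document; each statement's English description precedes it below -/
import Mathlib

section
/- Suppose A ⊆ M^k is definable and open, and B ⊆ A is definable and dense in A. Then the interior of B is dense in A, and B is almost all of A. -/
/-! Common framework: dp-minimal structures with a definable uniform structure,
following "Dp-minimal structures equipped with definable uniformities". -/

namespace DpTame

open FirstOrder Set Cardinal

universe u

variable (L : FirstOrder.Language.{u, u}) (M : Type u) [L.Structure M]

/-- `A ⊆ M^α` is definable with parameters from `C ⊆ M`. -/
def DefSetP (C : Set M) {α : Type} (A : Set (α → M)) : Prop :=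
  C.Definable L A

/-- `A ⊆ M^α` is definable (with parameters from `M`). -/
def DefSet {α : Type} (A : Set (α → M)) : Prop :=
  (Set.univ : Set M).Definable L A

/-- A subset of `M` is definable (with parameters). -/
def DefSet1 (A : Set M) : Prop :=
  DefSet L M {v : Fin 1 → M | v 0 ∈ A}

/-- A definable relation between two tuple sorts, with parameters from `C`. -/
def DefRelP (C : Set M) {k l : ℕ} (G : Set ((Fin k → M) × (Fin l → M))) : Prop :=
  DefSetP L M C {v : (Fin k ⊕ Fin l) → M | (v ∘ Sum.inl, v ∘ Sum.inr) ∈ G}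

/-- A definable relation between two tuple sorts, with parameters from `M`. -/
def DefRel {k l : ℕ} (G : Set ((Fin k → M) × (Fin l → M))) : Prop :=
  DefRelP L M Set.univ G

/-- A definable subset of `M × M`. -/
def DefRel1 (G : Set (M × M)) : Prop :=
  DefSet L M {v : Fin 2 → M | (v 0, v 1) ∈ G}

/-- Model-theoretic algebraic closure of a parameter set `C ⊆ M`:
`a` lies in a finite `C`-definable set. -/
def aclOf (C : Set M) : Set M :=
  {a | ∃ S : Set (Fin 1 → M), C.Definable L S ∧ S.Finite ∧ (fun _ => a) ∈ S}

/-- The acl-dimension of a tuple over `C`: the minimal size of a subtuple over which (together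
with `C`) the whole tuple is algebraic. -/
noncomputable def aclDimTuple (C : Set M) {k : ℕ} (a : Fin k → M) : ℕ :=
  sInf {l | ∃ s : Finset (Fin k), s.card = l ∧ ∀ i, a i ∈ aclOf L M (C ∪ (a '' ↑s))}

open Classical in
/-- The acl-dimension of a set `A ⊆ M^k` defined over `C` (with `⊥` for the empty set). -/
noncomputable def aclDim (C : Set M) {k : ℕ} (A : Set (Fin k → M)) : WithBot ℕ :=
  if A = ∅ then ⊥ else ↑(sSup {l | ∃ a ∈ A, aclDimTuple L M C a = l})

/-- `A ⊆ M^k` has dp-rank greater than `n`: there are (definable-with-parameters) formulas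
`φ_i(x,y)` for `i ≤ n` (coded as definable subsets of `M^k × M`) and infinite sets `B i ⊆ M`
such that every choice from `∏ B i` is coded by an element of `A`. -/
def DpRankGt {k : ℕ} (A : Set (Fin k → M)) (n : ℕ) : Prop :=
  ∃ (Φ : Fin (n + 1) → Set ((Fin k ⊕ Fin 1) → M)) (B : Fin (n + 1) → Set M),
    (∀ i, DefSet L M (Φ i)) ∧ (∀ i, (B i).Infinite) ∧
    ∀ b : Fin (n + 1) → M, (∀ i, b i ∈ B i) →
      ∃ a ∈ A, ∀ i, ∀ y ∈ B i, (Sum.elim a (fun _ => y) ∈ Φ i ↔ y = b i)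

open Classical in
/-- The dp-rank of a definable set, with `⊥` for the empty set. -/
noncomputable def dpRank {k : ℕ} (A : Set (Fin k → M)) : WithBot ℕ :=
  if A = ∅ then ⊥ else ↑(sSup {m : ℕ | ∃ n, m = n + 1 ∧ DpRankGt L M A n})

/-- Dp-minimality (with respect to the home sort `M`): `M` does not have dp-rank greater
than one. -/
def DpMinimal : Prop :=
  ¬ DpRankGt L M (Set.univ : Set (Fin 1 → M)) 1

/-- `M` is NIP: no definable relation has the independence property. -/
def IsNIP : Prop :=
  ∀ (n m : ℕ) (Φ : Set ((Fin n ⊕ Fin m) → M)), DefSet L M Φ →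
    ¬ ∃ (a : ℕ → Fin n → M) (b : Finset ℕ → Fin m → M),
        ∀ (i : ℕ) (s : Finset ℕ), (Sum.elim (a i) (b s) ∈ Φ ↔ i ∈ s)

/-- Every finitely satisfiable collection of formulas in one variable over `C` is realized. -/
def RealizesTypesOver (C : Set M) : Prop :=
  ∀ p : Set ((L[[C]]).Formula (Fin 1)),
    (∀ s : Finset ((L[[C]]).Formula (Fin 1)), ↑s ⊆ p →
      ∃ a : M, ∀ φ ∈ s, φ.Realize (fun _ => a)) →
    ∃ a : M, ∀ φ ∈ p, φ.Realize (fun _ => a)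

/-- `M` is `|L|⁺`-saturated. -/
def IsLPlusSaturated : Prop :=
  ∀ C : Set M, #C ≤ L.card + ℵ₀ → RealizesTypesOver L M C

/-- Two tuples have the same type over `C`. -/
def SameTypeOver (C : Set M) {n : ℕ} (a b : Fin n → M) : Prop :=
  ∀ φ : (L[[C]]).Formula (Fin n), φ.Realize a ↔ φ.Realize b

/-- A sequence indexed by `ℕ` is indiscernible over `C`. -/
def IndiscernibleOver (C : Set M) (I : ℕ → M) : Prop :=
  ∀ (n : ℕ) (f g : Fin n → ℕ), StrictMono f → StrictMono g →
    SameTypeOver L M C (I ∘ f) (I ∘ g)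

/-- The sequences `I l` are mutually indiscernible over `C`: each is indiscernible over `C`
together with all of the other sequences. -/
def MutuallyIndiscernibleOver (C : Set M) {k : ℕ} (I : Fin k → ℕ → M) : Prop :=
  ∀ l : Fin k,
    IndiscernibleOver L M (C ∪ ⋃ m ∈ ({m : Fin k | m ≠ l} : Set (Fin k)), Set.range (I m)) (I l)

/-- A correspondence with domain `E ⊆ M^k`, values in `M^l`, definable over `C`: a definable
graph all of whose fibers over points of `E` are finite and nonempty. -/
def IsCorrP (C : Set M) {k l : ℕ} (E : Set (Fin k → M))
    (G : Set ((Fin k → M) × (Fin l → M))) : Prop :=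
  DefRelP L M C G ∧ (∀ p ∈ G, p.1 ∈ E) ∧
    ∀ x ∈ E, {y | (x, y) ∈ G}.Nonempty ∧ {y | (x, y) ∈ G}.Finite

/-- A correspondence, definable with arbitrary parameters. -/
def IsCorr {k l : ℕ} (E : Set (Fin k → M)) (G : Set ((Fin k → M) × (Fin l → M))) : Prop :=
  IsCorrP L M Set.univ E G

/-- An `m`-correspondence: every fiber has exactly `m` elements. -/
def IsMCorrP (C : Set M) {k l : ℕ} (E : Set (Fin k → M))
    (G : Set ((Fin k → M) × (Fin l → M))) (m : ℕ) : Prop :=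
  IsCorrP L M C E G ∧ ∀ x ∈ E, {y | (x, y) ∈ G}.ncard = m

/-- An `m`-correspondence definable with arbitrary parameters. -/
def IsMCorr {k l : ℕ} (E : Set (Fin k → M)) (G : Set ((Fin k → M) × (Fin l → M)))
    (m : ℕ) : Prop :=
  IsMCorrP L M Set.univ E G m

/-- A definable uniform structure on `M`: a definable basis of entourages
`{φ(M², c̄) : c̄ ∈ dom}` satisfying the axioms for a basis of a (Hausdorff) uniformity. -/
structure DefUniformBasis where
  n : ℕ
  dom : Set (Fin n → M)
  dom_nonempty : dom.Nonempty
  dom_def : DefSet L M dom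
  phi : Set ((Fin 2 ⊕ Fin n) → M)
  phi_def : DefSet L M phi
  symm : ∀ c ∈ dom, ∀ x y : M, Sum.elim ![x, y] c ∈ phi → Sum.elim ![y, x] c ∈ phi
  inter_eq_diag : ∀ x y : M, (∀ c ∈ dom, Sum.elim ![x, y] c ∈ phi) ↔ x = y
  directed : ∀ c ∈ dom, ∀ d ∈ dom, ∃ e ∈ dom, ∀ x y : M,
    Sum.elim ![x, y] e ∈ phi → Sum.elim ![x, y] c ∈ phi ∧ Sum.elim ![x, y] d ∈ phi
  comp : ∀ c ∈ dom, ∃ d ∈ dom, ∀ x y z : M,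
    Sum.elim ![x, y] d ∈ phi → Sum.elim ![y, z] d ∈ phi → Sum.elim ![x, z] c ∈ phi

namespace DefUniformBasis

variable {L M} (U : DefUniformBasis L M)

/-- The entourage with parameter `c`. -/
def ent (c : Fin U.n → M) : Set (M × M) :=
  {p | Sum.elim ![p.1, p.2] c ∈ U.phi}

/-- The ball of radius `c` around `x ∈ M`. -/
def ball (c : Fin U.n → M) (x : M) : Set M :=
  {y | (x, y) ∈ U.ent c}

/-- The ball of radius `c` around `x ∈ M^k` (product uniformity). -/
def ballk {k : ℕ} (c : Fin U.n → M) (x : Fin k → M) : Set (Fin k → M) :=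
  {y | ∀ i, (x i, y i) ∈ U.ent c}

/-- Openness in `M` for the topology induced by the uniform structure. -/
def IsOpen1 (A : Set M) : Prop :=
  ∀ x ∈ A, ∃ c ∈ U.dom, U.ball c x ⊆ A

/-- Interior in `M`. -/
def interior1 (A : Set M) : Set M :=
  {x | ∃ c ∈ U.dom, U.ball c x ⊆ A}

/-- Closure in `M`. -/
def closure1 (A : Set M) : Set M :=
  {x | ∀ c ∈ U.dom, (U.ball c x ∩ A).Nonempty}

/-- Openness in `M^k` for the product topology. -/
def IsOpenk {k : ℕ} (A : Set (Fin k → M)) : Prop :=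
  ∀ x ∈ A, ∃ c ∈ U.dom, U.ballk c x ⊆ A

/-- Interior in `M^k`. -/
def interiork {k : ℕ} (A : Set (Fin k → M)) : Set (Fin k → M) :=
  {x | ∃ c ∈ U.dom, U.ballk c x ⊆ A}

/-- Closure in `M^k`. -/
def closurek {k : ℕ} (A : Set (Fin k → M)) : Set (Fin k → M) :=
  {x | ∀ c ∈ U.dom, (U.ballk c x ∩ A).Nonempty}

/-- The frontier `∂A = cl(A) ∖ A`. -/
def frontierk {k : ℕ} (A : Set (Fin k → M)) : Set (Fin k → M) :=
  U.closurek A \ A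

/-- Closedness in `M^k`. -/
def IsClosedk {k : ℕ} (A : Set (Fin k → M)) : Prop :=
  U.closurek A ⊆ A

/-- `B` is dense in `A`. -/
def DenseIn {k : ℕ} (B A : Set (Fin k → M)) : Prop :=
  A ⊆ U.closurek B

/-- `A ⊆ M^k` is locally closed: every point of `A` has a (ball) neighborhood `W` such that
`A ∩ W` is closed in `W`. -/
def IsLocallyClosedk {k : ℕ} (A : Set (Fin k → M)) : Prop :=
  ∀ x ∈ A, ∃ c ∈ U.dom, U.ballk c x ∩ U.closurek (A ∩ U.ballk c x) ⊆ A

open Classical in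
/-- The naive topological dimension of `A ⊆ M^k`: the largest `l` such that some coordinate
projection of `A` to `M^l` has nonempty interior (`⊥` for the empty set). -/
noncomputable def topDim {k : ℕ} (A : Set (Fin k → M)) : WithBot ℕ :=
  if A = ∅ then ⊥ else
    ↑(sSup {l : ℕ | ∃ σ : Fin l → Fin k, Function.Injective σ ∧
        (U.interiork ((fun v => v ∘ σ) '' A)).Nonempty})

/-- Continuity of a correspondence with domain `E` and graph `G` at a point `x ∈ E`. -/
def CorrContAt {k l : ℕ} (E : Set (Fin k → M)) (G : Set ((Fin k → M) × (Fin l → M)))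
    (x : Fin k → M) : Prop :=
  ∀ c ∈ U.dom, ∃ d ∈ U.dom, ∀ x' ∈ E, x' ∈ U.ballk d x →
    (∀ y, (x, y) ∈ G → ∃ y', (x', y') ∈ G ∧ ∀ j, (y j, y' j) ∈ U.ent c) ∧
    (∀ y', (x', y') ∈ G → ∃ y, (x, y) ∈ G ∧ ∀ j, (y j, y' j) ∈ U.ent c)

/-- Continuity of a correspondence at every point of its domain. -/
def CorrContOn {k l : ℕ} (E : Set (Fin k → M)) (G : Set ((Fin k → M) × (Fin l → M))) : Prop :=
  ∀ x ∈ E, U.CorrContAt E G x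

/-- Continuity of a function `M^k → M^l` on a set `V` (relative topology). -/
def ContOn {k l : ℕ} (f : (Fin k → M) → (Fin l → M)) (V : Set (Fin k → M)) : Prop :=
  ∀ x ∈ V, ∀ c ∈ U.dom, ∃ d ∈ U.dom, ∀ y ∈ V, y ∈ U.ballk d x → f y ∈ U.ballk c (f x)

/-- `f` restricted to `V` is a homeomorphism onto its image. -/
def HomeoOnto {k l : ℕ} (f : (Fin k → M) → (Fin l → M)) (V : Set (Fin k → M)) : Prop :=
  Set.InjOn f V ∧ U.ContOn f V ∧
    ∀ x ∈ V, ∀ c ∈ U.dom, ∃ d ∈ U.dom, ∀ y ∈ V, f y ∈ U.ballk d (f x) → y ∈ U.ballk c x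

/-- Continuity of a function `M → M` on a set `V`. -/
def Cont1On (f : M → M) (V : Set M) : Prop :=
  ∀ x ∈ V, ∀ c ∈ U.dom, ∃ d ∈ U.dom, ∀ y ∈ V, y ∈ U.ball d x → f y ∈ U.ball c (f x)

/-- `f : M → M` restricted to `V` is a homeomorphism onto its image. -/
def Homeo1Onto (f : M → M) (V : Set M) : Prop :=
  Set.InjOn f V ∧ U.Cont1On f V ∧
    ∀ x ∈ V, ∀ c ∈ U.dom, ∃ d ∈ U.dom, ∀ y ∈ V, f y ∈ U.ball d (f x) → y ∈ U.ball c x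

end DefUniformBasis

/-- The standing assumptions of the paper: `M` is an infinite `|L|⁺`-saturated NIP dp-minimal
structure carrying a definable uniform structure whose topology has no isolated points and in
which every infinite definable subset of `M` has nonempty interior (Inf). -/
structure Setting extends DefUniformBasis L M where
  nonempty : Nonempty M
  saturated : IsLPlusSaturated L M
  nip : IsNIP L M
  dpMin : DpMinimal L M
  noIsolated : ∀ x : M, ∀ c ∈ toDefUniformBasis.dom, ∃ y, y ≠ x ∧
    y ∈ toDefUniformBasis.ball c x
  infInterior : ∀ A : Set M, DefSet1 L M A → A.Infinite →
    (toDefUniformBasis.interior1 A).Nonempty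

end DpTame

namespace DpTame

open FirstOrder Set Cardinal Topology Filter

universe u

variable {L : FirstOrder.Language.{u, u}} {M : Type u} [L.Structure M]

/-! ### Definability and countable saturation -/

lemma DefSet.finCons_fiber {k : ℕ} {D : Set (Fin (k + 1) → M)} (hD : DefSet L M D) (y : M) :
    DefSet L M {x : Fin k → M | (Fin.cons y x : Fin (k + 1) → M) ∈ D} := by
  refine Set.Definable.preimage_map (F := fun x : Fin k → M => (Fin.cons y x : Fin (k + 1) → M))
    (fun i => ?_) hD
  refine Fin.cases ?_ (fun j => ?_) i
  · simpa using L.definableFun_const (Fin k) (mem_univ y)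
  · simpa using DefinableFun.proj L

lemma DefSet.finCons_fiber_head {k : ℕ} {D : Set (Fin (k + 1) → M)} (hD : DefSet L M D)
    (x : Fin k → M) : DefSet1 L M {y : M | (Fin.cons y x : Fin (k + 1) → M) ∈ D} := by
  refine Set.Definable.preimage_map
    (F := fun v : Fin 1 → M => (Fin.cons (v 0) x : Fin (k + 1) → M)) (fun i => ?_) hD
  refine Fin.cases ?_ (fun j => ?_) i
  · simpa using DefinableFun.proj L
  · simpa using L.definableFun_const (Fin 1) (mem_univ (x j))

lemma DefSet1.preimage_eval {α : Type} {P : Set M} (hP : DefSet1 L M P) (i : α) :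
    DefSet L M {v : α → M | v i ∈ P} :=
  Definable.preimage_comp (fun _ : Fin 1 => i) hP

lemma DefSet.image_tail {k : ℕ} {D : Set (Fin (k + 1) → M)} (hD : DefSet L M D) :
    DefSet L M {x : Fin k → M | ∃ y : M, (Fin.cons y x : Fin (k + 1) → M) ∈ D} := by
  convert! Definable.image_comp hD Fin.succ using 1
  ext x
  constructor
  · rintro ⟨y, hy⟩
    exact ⟨_, hy, funext fun i => by simp⟩
  · rintro ⟨v, hv, rfl⟩
    exact ⟨v 0, by convert! hv; exact Fin.cons_self_tail v⟩

lemma DefSet.image_head {k : ℕ} {D : Set (Fin (k + 1) → M)} (hD : DefSet L M D) :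
    DefSet1 L M {y : M | ∃ x : Fin k → M, (Fin.cons y x : Fin (k + 1) → M) ∈ D} := by
  unfold DefSet1
  convert! Definable.image_comp hD (fun _ : Fin 1 => (0 : Fin (k + 1))) using 1
  ext y
  constructor
  · rintro ⟨x, hx⟩
    exact ⟨_, hx, funext fun i => by simp [Subsingleton.elim i 0]⟩
  · rintro ⟨v, hv, rfl⟩
    exact ⟨Fin.tail v, by convert! hv; exact Fin.cons_self_tail v⟩

lemma IsLPlusSaturated.exists_forall_mem1 (hsat : IsLPlusSaturated L M) {D : ℕ → Set M}
    (hD : ∀ n, DefSet1 L M (D n)) (hanti : Antitone D) (hne : ∀ n, (D n).Nonempty) :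
    ∃ y, ∀ n, y ∈ D n := by
  classical
  choose C _ hC using fun n => definable_iff_finitely_definable.1 (hD n)
  have hcount : (⋃ n, (C n : Set M)).Countable := countable_iUnion fun n => (C n).countable_toSet
  choose φ hφ using fun n => (hC n).mono (subset_iUnion (fun n => (C n : Set M)) n)
  have hmem (n : ℕ) (y : M) : (φ n).Realize (fun _ => y) ↔ y ∈ D n := by
    have : (fun _ : Fin 1 => y) ∈ {v : Fin 1 → M | v 0 ∈ D n} ↔ (φ n).Realize (fun _ => y) := by
      rw [hφ n]; rfl
    exact this.symm
  obtain ⟨y, hy⟩ := hsat _ ((le_aleph0_iff_set_countable.2 hcount).trans le_add_self)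
    (range φ) fun s hs => by
      rw [← image_univ, Finset.subset_set_image_iff] at hs
      obtain ⟨t, -, rfl⟩ := hs
      obtain ⟨y, hy⟩ := hne (t.sup id)
      refine ⟨y, fun ψ hψ => ?_⟩
      obtain ⟨n, hn, rfl⟩ := Finset.mem_image.1 hψ
      exact (hmem n y).2 (hanti (Finset.le_sup (f := id) hn) hy)
  exact ⟨y, fun n => (hmem n y).1 (hy _ (mem_range_self n))⟩

/-- Decreasing sequences of nonempty definable sets have nonempty intersection. -/
lemma IsLPlusSaturated.exists_forall_mem (hsat : IsLPlusSaturated L M) {k : ℕ}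
    {D : ℕ → Set (Fin k → M)} (hD : ∀ n, DefSet L M (D n)) (hanti : Antitone D)
    (hne : ∀ n, (D n).Nonempty) : ∃ x, ∀ n, x ∈ D n := by
  induction k with
  | zero => exact ⟨(hne 0).some, fun n => by
      obtain ⟨z, hz⟩ := hne n
      rwa [Subsingleton.elim (hne 0).some z]⟩
  | succ k ih =>
    obtain ⟨y, hy⟩ := hsat.exists_forall_mem1 (fun n => (hD n).image_head)
      (fun m n hmn y ⟨x, hx⟩ => ⟨x, hanti hmn hx⟩) fun n => by
        obtain ⟨v, hv⟩ := hne n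
        exact ⟨v 0, Fin.tail v, by simpa using hv⟩
    obtain ⟨x, hx⟩ := ih (fun n => (hD n).finCons_fiber y) (fun m n hmn x hx => hanti hmn hx) hy
    exact ⟨_, hx⟩

/-! ### Somewhere dense definable sets -/

section Topological

variable [TopologicalSpace M]

lemma _root_.Topology.exists_seq_disjoint_open_subsets {X : Type*} [TopologicalSpace X] [T2Space X]
    {W : Set X} (hW : IsOpen W) (hinf : W.Infinite) :
    ∃ U : ℕ → Set X, (∀ n, (U n).Nonempty) ∧ (∀ n, IsOpen (U n)) ∧ (∀ n, U n ⊆ W) ∧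
      Pairwise (Function.onFun Disjoint U) := by
  have := hinf.to_subtype
  obtain ⟨U, hUi, hUo, hUd⟩ := exists_seq_infinite_isOpen_pairwise_disjoint W
  refine ⟨fun n => Subtype.val '' U n, fun n => (hUi n).nonempty.image _,
    fun n => hW.isOpenMap_subtype_val _ (hUo n), fun n => Subtype.coe_image_subset _ _,
    fun m n hmn => ?_⟩
  exact (disjoint_image_iff Subtype.val_injective).2 (hUd hmn)

/-- Every somewhere dense definable subset of `M^k` has interior, locally. -/
def SomewhereDenseProp (L : FirstOrder.Language.{u, u}) (M : Type u) [L.Structure M]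
    [TopologicalSpace M] (k : ℕ) : Prop :=
  ∀ (B O : Set (Fin k → M)), DefSet L M B → IsOpen O → O.Nonempty → O ⊆ closure B →
    (interior B ∩ O).Nonempty

lemma SomewhereDenseProp.subset_closure_interior {k : ℕ} (h : SomewhereDenseProp L M k)
    {B O : Set (Fin k → M)} (hB : DefSet L M B) (hO : IsOpen O) (hBO : O ⊆ closure B) :
    O ⊆ closure (interior B) := by
  intro x hx
  rw [mem_closure_iff]
  intro N hN hxN
  obtain ⟨z, hz, hzN, -⟩ := h B (N ∩ O) hB (hN.inter hO) ⟨x, hxN, hx⟩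
    (inter_subset_right.trans hBO)
  exact ⟨z, hzN, hz⟩

lemma SomewhereDenseProp.dense_inter {k : ℕ} (h : SomewhereDenseProp L M k)
    {B C O : Set (Fin k → M)} (hB : DefSet L M B) (hO : IsOpen O)
    (hBO : O ⊆ closure B) (hCO : O ⊆ closure C) : O ⊆ closure (B ∩ C) := by
  intro x hx
  rw [mem_closure_iff]
  intro N hN hxN
  obtain ⟨z, hz, hzN⟩ := h B (N ∩ O) hB (hN.inter hO) ⟨x, hxN, hx⟩
    (inter_subset_right.trans hBO)
  obtain ⟨w, ⟨hwB, hwN⟩, hwC⟩ := mem_closure_iff.1 (hCO hzN.2) _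
    (isOpen_interior.inter (hN.inter hO)) ⟨hz, hzN⟩
  exact ⟨w, hwN.1, interior_subset hwB, hwC⟩

lemma SomewhereDenseProp.dense_biInter {k : ℕ} (h : SomewhereDenseProp L M k) {ι : Type*}
    {B : ι → Set (Fin k → M)} {O : Set (Fin k → M)} (hB : ∀ i, DefSet L M (B i)) (hO : IsOpen O)
    (hBO : ∀ i, O ⊆ closure (B i)) (s : Finset ι) : O ⊆ closure (⋂ i ∈ s, B i) := by
  classical
  induction s using Finset.induction_on with
  | empty => simp
  | insert i s _ ih =>
    rw [Finset.set_biInter_insert]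
    exact h.dense_inter (hB i) hO (hBO i) ih

/-- If definable `B i ⊆ M × M^k` are dense in the open box `W × V`, then some `x` has fibers over
it with interior in every member of a given finite family of open subsets of `W`. -/
lemma SomewhereDenseProp.exists_fibers_interior {k : ℕ} (h : SomewhereDenseProp L M k)
    [T2Space M] [∀ x : M, (𝓝[≠] x).NeBot] (hsat : IsLPlusSaturated L M)
    (hbasis : ∀ x : M, ∀ N ∈ 𝓝 x, ∃ P ∈ 𝓝 x, P ⊆ N ∧ DefSet1 L M P)
    (hinf : ∀ A : Set M, DefSet1 L M A → A.Infinite → (interior A).Nonempty)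
    {ι : Type*} [Finite ι] {B : ι → Set (Fin (k + 1) → M)} (hB : ∀ i, DefSet L M (B i))
    {V : Set (Fin k → M)} (hV : IsOpen V) (hVne : V.Nonempty) (W : ι → Set M)
    (hW : ∀ i, IsOpen (W i)) (hWne : ∀ i, (W i).Nonempty)
    (hdense : ∀ i, ∀ y ∈ W i, ∀ x ∈ V, (Fin.cons y x : Fin (k + 1) → M) ∈ closure (B i)) :
    ∃ x : Fin k → M, ∀ i,
      (interior {y | y ∈ W i ∧ (Fin.cons y x : Fin (k + 1) → M) ∈ B i}).Nonempty := by
  choose w hw using hWne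
  choose G hGn hGW hGdef using fun i => hbasis (w i) (W i) ((hW i).mem_nhds (hw i))
  choose U hUne hUo hUG hUd using fun i =>
    Topology.exists_seq_disjoint_open_subsets (isOpen_interior (s := G i))
      (infinite_of_mem_nhds (w i) (interior_mem_nhds.2 (hGn i)))
  choose p hp using hUne
  choose P hPn hPU hPdef using fun i n => hbasis (p i n) (U i n) ((hUo i n).mem_nhds (hp i n))
  let E : ι × ℕ → Set (Fin k → M) := fun q =>
    {x | ∃ y, (Fin.cons y x : Fin (k + 1) → M) ∈ B q.1 ∩ {v | v 0 ∈ P q.1 q.2}}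
  have hE (q) : DefSet L M (E q) :=
    DefSet.image_tail (Definable.inter (hB q.1) ((hPdef q.1 q.2).preimage_eval 0))
  have hED (q) : V ⊆ closure (E q) := by
    intro x hx
    rw [mem_closure_iff]
    intro N hN hxN
    have hmem : p q.1 q.2 ∈ W q.1 :=
      hGW _ (interior_subset (hUG _ _ (hp q.1 q.2)))
    obtain ⟨v, ⟨hvP, hvN⟩, hvB⟩ := mem_closure_iff.1 (hdense q.1 _ hmem x hx)
      {v | v 0 ∈ interior (P q.1 q.2) ∧ Fin.tail v ∈ N}
      ((isOpen_interior.preimage (continuous_apply 0)).inter (hN.preimage continuous_id.finTail))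
      ⟨by simpa using mem_interior_iff_mem_nhds.2 (hPn q.1 q.2), by simpa using hxN⟩
    exact ⟨Fin.tail v, hvN, v 0, by simpa using hvB, by simpa using interior_subset hvP⟩
  have := Fintype.ofFinite ι
  obtain ⟨x, hx⟩ := hsat.exists_forall_mem
    (D := fun n => ⋂ q ∈ (Finset.univ ×ˢ Finset.range n : Finset (ι × ℕ)), E q)
    (fun n => definable_biInter_finset hE _)
    (fun m n hmn => biInter_subset_biInter_left fun q hq => by
      have : q.2 < m := by simpa using hq
      simpa using this.trans_le hmn)
    (fun n => closure_nonempty_iff.1 (hVne.mono (h.dense_biInter hE hV hED _)))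
  have hx' (q) : x ∈ E q := by
    have := hx (q.2 + 1)
    simp only [mem_iInter] at this
    exact this q (by simp)
  refine ⟨x, fun i => ?_⟩
  choose y hyB hyP using fun n => hx' (i, n)
  have hyU (n) : y n ∈ U i n := hPU i n (by simpa using hyP n)
  refine (hinf {y | y ∈ G i ∧ (Fin.cons y x : Fin (k + 1) → M) ∈ B i}
    (Definable.inter (hGdef i) ((hB i).finCons_fiber_head x)) ?_).mono
    (interior_mono fun z hz => ⟨hGW i hz.1, hz.2⟩)
  refine (infinite_range_of_injective (f := y) fun m n hmn => ?_).mono ?_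
  · by_contra hne
    exact disjoint_left.1 (hUd i hne) (hyU m) (hmn ▸ hyU n)
  · rintro _ ⟨n, rfl⟩
    exact ⟨interior_subset (hUG i n (hyU n)), hyB n⟩

lemma SomewhereDenseProp.zero : SomewhereDenseProp L M 0 := by
  intro B O _ _ hOne hOB
  obtain ⟨z, hz⟩ := closure_nonempty_iff.1 (hOne.mono hOB)
  have : B = Set.univ := eq_univ_of_forall fun w => Subsingleton.elim z w ▸ hz
  simpa [this] using hOne

lemma SomewhereDenseProp.succ {k : ℕ} (h : SomewhereDenseProp L M k)
    [T2Space M] [∀ x : M, (𝓝[≠] x).NeBot] (hsat : IsLPlusSaturated L M) (hnip : IsNIP L M)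
    (hbasis : ∀ x : M, ∀ N ∈ 𝓝 x, ∃ P ∈ 𝓝 x, P ⊆ N ∧ DefSet1 L M P)
    (hinf : ∀ A : Set M, DefSet1 L M A → A.Infinite → (interior A).Nonempty) :
    SomewhereDenseProp L M (k + 1) := by
  classical
  rintro B O hB hO ⟨v, hv⟩ hOB
  by_contra hempty
  rw [not_nonempty_iff_eq_empty] at hempty
  have hOC : O ⊆ closure Bᶜ := by
    rw [closure_compl]
    exact fun z hz hzB => hempty.subset ⟨hzB, hz⟩
  have hcons : Continuous fun p : M × (Fin k → M) => (Fin.cons p.1 p.2 : Fin (k + 1) → M) :=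
    Continuous.finCons (A := fun _ => M) continuous_fst continuous_snd
  obtain ⟨W, V, hW, hV, hvW, hvV, hWV⟩ := isOpen_prod_iff.1 (hO.preimage hcons) (v 0) (Fin.tail v)
    (by simpa using hv)
  let 𝒮 := {𝓦 : Set (Set M) // 𝓦.Finite ∧ ∀ U ∈ 𝓦, IsOpen U ∧ U.Nonempty ∧ U ⊆ W}
  have split (𝓦 : 𝒮) : ∃ (x : Fin k → M) (𝓦' : 𝒮), ∀ U ∈ 𝓦.1, ∀ p : Prop, ∃ U' ∈ 𝓦'.1, U' ⊆ U ∧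
      ∀ y ∈ U', ((Fin.cons y x : Fin (k + 1) → M) ∈ B ↔ p) := by
    obtain ⟨𝓦, hfin, h𝓦⟩ := 𝓦
    have := hfin.to_subtype
    obtain ⟨x, hx⟩ := h.exists_fibers_interior hsat hbasis hinf (ι := 𝓦 × Bool)
      (B := fun q => if q.2 then B else Bᶜ)
      (fun q => by split_ifs; exacts [hB, hB.compl]) hV ⟨_, hvV⟩ (fun q => q.1.1)
      (fun q => (h𝓦 _ q.1.2).1) (fun q => (h𝓦 _ q.1.2).2.1) (fun q y hy x hx => by
        have hyx : (Fin.cons y x : Fin (k + 1) → M) ∈ O :=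
          hWV (mk_mem_prod ((h𝓦 _ q.1.2).2.2 hy) hx)
        split_ifs
        exacts [hOB hyx, hOC hyx])
    let T : 𝓦 × Bool → Set M := fun q => interior
      {y | y ∈ q.1.1 ∧ (Fin.cons y x : Fin (k + 1) → M) ∈ if q.2 then B else Bᶜ}
    refine ⟨x, ⟨range T, finite_range T, ?_⟩, fun U hU p =>
      ⟨_, mem_range_self (⟨U, hU⟩, decide p), fun y hy => (interior_subset hy).1, fun y hy => ?_⟩⟩
    · rintro _ ⟨q, rfl⟩
      exact ⟨isOpen_interior, hx q, fun y hy => (h𝓦 _ q.1.2).2.2 (interior_subset hy).1⟩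
    · have := (interior_subset hy).2
      by_cases hp : p <;> simpa [hp] using this
  choose x F hF using split
  let 𝓦 : ℕ → 𝒮 := fun n => Nat.rec ⟨{W}, finite_singleton _, by
    rintro _ rfl; exact ⟨hW, ⟨_, hvW⟩, subset_rfl⟩⟩ (fun _ => F) n
  let a : ℕ → Fin k → M := fun n => x (𝓦 n)
  have shatter (s : Finset ℕ) (n : ℕ) : ∃ U ∈ (𝓦 n).1, ∀ y ∈ U, ∀ i < n,
      ((Fin.cons y (a i) : Fin (k + 1) → M) ∈ B ↔ i ∈ s) := by
    induction n with
    | zero => exact ⟨W, rfl, by simp⟩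
    | succ n ih =>
      obtain ⟨U, hU, hUs⟩ := ih
      obtain ⟨U', hU', hU'U, hU's⟩ := hF (𝓦 n) U hU (n ∈ s)
      refine ⟨U', hU', fun y hy i hi => ?_⟩
      rcases Nat.lt_succ_iff_lt_or_eq.1 hi with hi | rfl
      exacts [hUs y (hU'U hy) i hi, hU's y hy]
  have realize (s : Finset ℕ) : ∃ y : M, ∀ i, (Fin.cons y (a i) : Fin (k + 1) → M) ∈ B ↔ i ∈ s := by
    obtain ⟨y, hy⟩ := hsat.exists_forall_mem1
      (D := fun n => {y | ∀ i ∈ Finset.range n, (Fin.cons y (a i) : Fin (k + 1) → M) ∈ B ↔ i ∈ s})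
      (fun n => by
        have hdef (i : ℕ) :
            DefSet1 L M {y | (Fin.cons y (a i) : Fin (k + 1) → M) ∈ B ↔ i ∈ s} := by
          by_cases hi : i ∈ s
          · simpa [hi] using hB.finCons_fiber_head (a i)
          · simpa [hi] using (DefSet.finCons_fiber_head hB.compl (a i))
        unfold DefSet1 DefSet
        convert! definable_biInter_finset hdef (Finset.range n) using 1
        ext v
        simp)
      (fun m n hmn y hy i hi => hy i (Finset.range_mono hmn hi))
      (fun n => by
        obtain ⟨U, hU, hUs⟩ := shatter s n
        obtain ⟨y, hy⟩ := ((𝓦 n).2.2 U hU).2.1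
        exact ⟨y, fun i hi => hUs y hy i (Finset.mem_range.1 hi)⟩)
    exact ⟨y, fun i => hy (i + 1) i (by simp)⟩
  choose b hb using realize
  refine hnip k 1 {w | (Fin.cons (w (.inr 0)) (w ∘ .inl) : Fin (k + 1) → M) ∈ B} ?_
    ⟨a, fun s _ => b s, fun i s => hb s i⟩
  unfold DefSet
  convert! Definable.preimage_comp (Fin.cons (.inr 0) .inl : Fin (k + 1) → Fin k ⊕ Fin 1) hB using 1
  ext w
  have : (Fin.cons (w (.inr 0)) (w ∘ .inl) : Fin (k + 1) → M) =
      w ∘ (Fin.cons (.inr 0) .inl : Fin (k + 1) → Fin k ⊕ Fin 1) := by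
    funext i
    refine Fin.cases ?_ (fun j => ?_) i <;> simp
  simp [this]

lemma somewhereDenseProp [T2Space M] [∀ x : M, (𝓝[≠] x).NeBot] (hsat : IsLPlusSaturated L M)
    (hnip : IsNIP L M) (hbasis : ∀ x : M, ∀ N ∈ 𝓝 x, ∃ P ∈ 𝓝 x, P ⊆ N ∧ DefSet1 L M P)
    (hinf : ∀ A : Set M, DefSet1 L M A → A.Infinite → (interior A).Nonempty) (k : ℕ) :
    SomewhereDenseProp L M k := by
  induction k with
  | zero => exact .zero
  | succ k ih => exact ih.succ hsat hnip hbasis hinf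

end Topological

/-! ### The topology of a definable uniform structure -/

namespace DefUniformBasis

variable (U : DefUniformBasis L M)

/-- The topology on `M` induced by a definable uniform structure. -/
abbrev topology : TopologicalSpace M :=
  .mkOfNhds fun x => ⨅ c ∈ U.dom, 𝓟 (U.ball c x)

lemma mem_ball_self {c : Fin U.n → M} (hc : c ∈ U.dom) (x : M) : x ∈ U.ball c x :=
  (U.inter_eq_diag x x).2 rfl c hc

lemma hasBasis_iInf_ball (x : M) :
    (⨅ c ∈ U.dom, 𝓟 (U.ball c x)).HasBasis (· ∈ U.dom) (U.ball · x) := by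
  refine hasBasis_biInf_principal (fun c hc d hd => ?_) U.dom_nonempty
  obtain ⟨e, he, hecd⟩ := U.directed c hc d hd
  exact ⟨e, he, fun y hy => (hecd x y hy).1, fun y hy => (hecd x y hy).2⟩

lemma nhds_hasBasis (x : M) : (@nhds M U.topology x).HasBasis (· ∈ U.dom) (U.ball · x) := by
  rw [TopologicalSpace.nhds_mkOfNhds_of_hasBasis U.hasBasis_iInf_ball
    (fun y c hc => U.mem_ball_self hc y) (fun y c hc => ?_) x]
  · exact U.hasBasis_iInf_ball x
  · obtain ⟨d, hd, hdc⟩ := U.comp c hc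
    exact (U.hasBasis_iInf_ball y).mem_iff.2 ⟨d, hd, fun z hz =>
      (U.hasBasis_iInf_ball z).mem_iff.2 ⟨d, hd, fun w hw => hdc y z w hz hw⟩⟩

lemma t2Space : @T2Space M U.topology := by
  let := U.topology
  refine ⟨fun x y hxy => ?_⟩
  obtain ⟨c, hc, hcxy⟩ : ∃ c ∈ U.dom, y ∉ U.ball c x := by
    by_contra! hall
    exact hxy ((U.inter_eq_diag x y).1 hall)
  obtain ⟨d, hd, hdc⟩ := U.comp c hc
  obtain ⟨V, hVx, hV, hxV⟩ := mem_nhds_iff.1 ((U.nhds_hasBasis x).mem_of_mem hd)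
  obtain ⟨W, hWy, hW, hyW⟩ := mem_nhds_iff.1 ((U.nhds_hasBasis y).mem_of_mem hd)
  exact ⟨V, W, hV, hW, hxV, hyW, disjoint_left.2 fun z hzV hzW =>
    hcxy (hdc x z y (hVx hzV) (U.symm d hd y z (hWy hzW)))⟩

lemma exists_forall_ball_subset {ι : Type*} (s : Finset ι) (c : ι → Fin U.n → M)
    (hc : ∀ i, c i ∈ U.dom) : ∃ e ∈ U.dom, ∀ i ∈ s, ∀ x, U.ball e x ⊆ U.ball (c i) x := by
  classical
  induction s using Finset.induction_on with
  | empty => exact ⟨_, U.dom_nonempty.some_mem, by simp⟩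
  | insert i s _ ih =>
    obtain ⟨d, hd, hds⟩ := ih
    obtain ⟨e, he, hecd⟩ := U.directed (c i) (hc i) d hd
    refine ⟨e, he, fun j hj x y hy => ?_⟩
    rcases Finset.mem_insert.1 hj with rfl | hj
    exacts [(hecd x y hy).1, hds j hj x (hecd x y hy).2]

lemma mem_nhds_pi_iff {k : ℕ} {x : Fin k → M} {N : Set (Fin k → M)} :
    letI := U.topology
    N ∈ 𝓝 x ↔ ∃ c ∈ U.dom, U.ballk c x ⊆ N := by
  let := U.topology
  constructor
  · intro hN
    rw [nhds_pi, Filter.mem_pi] at hN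
    obtain ⟨I, -, t, ht, htN⟩ := hN
    choose c hc hct using fun i => (U.nhds_hasBasis (x i)).mem_iff.1 (ht i)
    obtain ⟨e, he, hec⟩ := U.exists_forall_ball_subset Finset.univ c hc
    exact ⟨e, he, fun y hy => htN fun i _ => hct i (hec i (Finset.mem_univ i) _ (hy i))⟩
  · rintro ⟨c, hc, hcN⟩
    refine Filter.mem_of_superset (set_pi_mem_nhds finite_univ
      fun i _ => (U.nhds_hasBasis (x i)).mem_of_mem hc) fun y hy => hcN fun i => hy i (mem_univ i)

lemma isOpenk_iff {k : ℕ} {A : Set (Fin k → M)} :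
    letI := U.topology
    U.IsOpenk A ↔ IsOpen A := by
  let := U.topology
  simp only [isOpen_iff_mem_nhds, U.mem_nhds_pi_iff, IsOpenk]

lemma interiork_eq {k : ℕ} (A : Set (Fin k → M)) :
    letI := U.topology
    U.interiork A = interior A := by
  let := U.topology
  ext x
  simp only [mem_interior_iff_mem_nhds, U.mem_nhds_pi_iff, interiork, mem_ofPred_eq]

lemma interior1_eq (A : Set M) :
    letI := U.topology
    U.interior1 A = interior A := by
  let := U.topology
  ext x
  simp only [mem_interior_iff_mem_nhds, (U.nhds_hasBasis x).mem_iff, interior1, mem_ofPred_eq]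

lemma closurek_eq {k : ℕ} (A : Set (Fin k → M)) :
    letI := U.topology
    U.closurek A = closure A := by
  let := U.topology
  ext x
  simp only [mem_closure_iff_nhds, U.mem_nhds_pi_iff, closurek, mem_ofPred_eq]
  exact ⟨fun h N ⟨c, hc, hcN⟩ => (h c hc).mono (inter_subset_inter_left _ hcN),
    fun h c hc => h _ ⟨c, hc, subset_rfl⟩⟩

lemma ball_def (c : Fin U.n → M) (x : M) : DefSet1 L M (U.ball c x) := by
  refine Set.Definable.preimage_map
    (F := fun v : Fin 1 → M => Sum.elim ![x, v 0] c) (fun i => ?_) U.phi_def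
  rcases i with i | i
  · fin_cases i
    · exact L.definableFun_const (Fin 1) (mem_univ x)
    · exact DefinableFun.proj L
  · exact L.definableFun_const (Fin 1) (mem_univ (c i))

lemma topDim_lt_of_interior_eq_empty {k : ℕ} {A B : Set (Fin k → M)} (hB : (U.interiork B).Nonempty)
    (hA : U.interiork A = ∅) : U.topDim A < U.topDim B := by
  classical
  let := U.topology
  have hBne : B ≠ ∅ := by
    rintro rfl
    simp [U.interiork_eq] at hB
  have bound (C : Set (Fin k → M)) : BddAbove {l : ℕ | ∃ σ : Fin l → Fin k, Function.Injective σ ∧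
      (U.interiork ((fun v => v ∘ σ) '' C)).Nonempty} :=
    ⟨k, fun l ⟨σ, hσ, _⟩ => by simpa using Fintype.card_le_of_injective σ hσ⟩
  unfold topDim
  rw [if_neg hBne]
  split_ifs with hAe
  · exact WithBot.bot_lt_coe _
  refine WithBot.coe_lt_coe.2 (lt_of_lt_of_le ?_ (le_csSup (bound B)
    ⟨id, Function.injective_id, by simpa using hB⟩))
  suffices hlt : ∀ l : ℕ, ∀ σ : Fin l → Fin k, Function.Injective σ →
      (U.interiork ((fun v => v ∘ σ) '' A)).Nonempty → l < k by
    obtain ⟨σ, hσ, hint⟩ := Nat.sSup_mem (s := {l : ℕ | ∃ σ : Fin l → Fin k,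
        Function.Injective σ ∧ (U.interiork ((fun v => v ∘ σ) '' A)).Nonempty})
      ⟨0, Fin.elim0, fun i => i.elim0, by
        have : (fun v : Fin k → M => v ∘ (Fin.elim0 : Fin 0 → Fin k)) '' A = Set.univ :=
          Subsingleton.eq_univ_of_nonempty ((nonempty_iff_ne_empty.2 hAe).image _)
        rw [this, U.interiork_eq, interior_univ]
        exact univ_nonempty⟩ (bound A)
    exact hlt _ σ hσ hint
  intro l σ hσ hint
  refine lt_of_le_of_ne (by simpa using Fintype.card_le_of_injective σ hσ) fun hlk => ?_
  have hσb : Function.Bijective σ :=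
    (Fintype.bijective_iff_injective_and_card σ).2 ⟨hσ, by simpa using hlk⟩
  rw [U.interiork_eq] at hint hA
  obtain ⟨w, hw⟩ := hint
  obtain ⟨v, -, rfl⟩ := interior_subset hw
  have hsub : (fun v : Fin k → M => v ∘ σ) ⁻¹' interior ((fun v => v ∘ σ) '' A) ⊆ A := by
    intro z hz
    obtain ⟨z', hz', hzz'⟩ := interior_subset hz
    rwa [← hσb.surjective.injective_comp_right hzz']
  have hcont : Continuous fun v : Fin k → M => v ∘ σ :=
    continuous_pi fun i => continuous_apply (σ i)
  exact hA.subset (interior_maximal hsub (isOpen_interior.preimage hcont) hw)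

end DefUniformBasis

lemma Setting.somewhereDenseProp (S : Setting L M) (k : ℕ) :
    letI := S.topology
    SomewhereDenseProp L M k := by
  let := S.topology
  have := S.t2Space
  have (x : M) : (𝓝[≠] x).NeBot := by
    rw [(nhdsWithin_hasBasis (S.nhds_hasBasis x) _).neBot_iff]
    intro c hc
    obtain ⟨y, hyx, hy⟩ := S.noIsolated x c hc
    exact ⟨y, hy, hyx⟩
  refine DpTame.somewhereDenseProp S.saturated S.nip (fun x N hN => ?_) (fun A hA hAinf => ?_) k
  · obtain ⟨c, hc, hcN⟩ := (S.nhds_hasBasis x).mem_iff.1 hN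
    exact ⟨_, (S.nhds_hasBasis x).mem_of_mem hc, hcN, S.ball_def c x⟩
  · rw [← S.interior1_eq]
    exact S.infInterior A hA hAinf

end DpTame

namespace DpTame

open FirstOrder Set Cardinal

universe u

variable {L : FirstOrder.Language.{u, u}} {M : Type u} [L.Structure M]

/-- If `A ⊆ M^k` is definable, open (and nonempty) and `B ⊆ A` is definable and
dense in `A`, then the interior of `B` is dense in `A` and `B` is almost all of `A`. -/
theorem statement15 (S : Setting L M) {k : ℕ} (A B : Set (Fin k → M))
    (hAdef : DefSet L M A) (hAopen : S.toDefUniformBasis.IsOpenk A) (hAne : A.Nonempty)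
    (hBA : B ⊆ A) (hBdef : DefSet L M B) (hdense : S.toDefUniformBasis.DenseIn B A) :
    S.toDefUniformBasis.DenseIn (S.toDefUniformBasis.interiork B) A ∧
      S.toDefUniformBasis.topDim (A \ B) < S.toDefUniformBasis.topDim A := by
  let := S.topology
  unfold DefUniformBasis.DenseIn at *
  rw [S.isOpenk_iff] at hAopen
  rw [S.closurek_eq] at hdense ⊢
  rw [S.interiork_eq]
  refine ⟨(S.somewhereDenseProp k).subset_closure_interior hBdef hAopen hdense,
    S.topDim_lt_of_interior_eq_empty ?_ ?_⟩
  · rwa [S.interiork_eq, hAopen.interior_eq]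
  · rw [S.interiork_eq, Set.eq_empty_iff_forall_notMem]
    intro x hx
    obtain ⟨y, hy, hyB⟩ := mem_closure_iff.1 (hdense (interior_subset hx).1) _ isOpen_interior hx
    exact (interior_subset hy).2 hyB

end DpTame
end

section
/- Let U ⊆ M^k be open and definable and let f: U ⇉ M^l be a continuous m-correspondence. Every p ∈ U has a neighborhood V such that there are definable continuous functions g_1, …, g_m: V → M^l with pairwise disjoint graphs such that Graph(f|_V) = Graph(g_1) ∪ ⋯ ∪ Graph(g_m). -/
namespace DpTame

open FirstOrder Set Cardinal

universe u

variable {L : FirstOrder.Language.{u, u}} {M : Type u} [L.Structure M]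

namespace DefUniformBasis

variable (U : DefUniformBasis L M)

theorem refl_mem_ent {c : Fin U.n → M} (hc : c ∈ U.dom) (x : M) : (x, x) ∈ U.ent c :=
  (U.inter_eq_diag x x).2 rfl c hc

theorem symm_mem_ent {c : Fin U.n → M} (hc : c ∈ U.dom) {x y : M} (h : (x, y) ∈ U.ent c) :
    (y, x) ∈ U.ent c :=
  U.symm c hc x y h

theorem exists_ent_subset_inter {c d : Fin U.n → M} (hc : c ∈ U.dom) (hd : d ∈ U.dom) :
    ∃ e ∈ U.dom, U.ent e ⊆ U.ent c ∩ U.ent d := by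
  obtain ⟨e, he, h⟩ := U.directed c hc d hd
  exact ⟨e, he, fun q hq => h q.1 q.2 hq⟩

theorem exists_ent_subset_of_finite {ι : Type*} [Finite ι] (c : ι → Fin U.n → M)
    (hc : ∀ i, c i ∈ U.dom) : ∃ e ∈ U.dom, ∀ i, U.ent e ⊆ U.ent (c i) := by
  classical
  have := Fintype.ofFinite ι
  suffices h : ∀ s : Finset ι, ∃ e ∈ U.dom, ∀ i ∈ s, U.ent e ⊆ U.ent (c i) by
    obtain ⟨e, he, h⟩ := h Finset.univ
    exact ⟨e, he, fun i => h i (Finset.mem_univ i)⟩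
  intro s
  induction s using Finset.induction_on with
  | empty =>
    obtain ⟨e, he⟩ := U.dom_nonempty
    exact ⟨e, he, by simp⟩
  | insert a s _ ih =>
    obtain ⟨e, he, h⟩ := ih
    obtain ⟨e', he', h'⟩ := U.exists_ent_subset_inter he (hc a)
    refine ⟨e', he', fun i hi => ?_⟩
    rcases Finset.mem_insert.1 hi with rfl | hi
    · exact fun q hq => (h' hq).2
    · exact fun q hq => h i hi (h' hq).1

/-- Every entourage contains the threefold composite of some entourage. -/
theorem exists_ent_comp_three {c : Fin U.n → M} (hc : c ∈ U.dom) :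
    ∃ e ∈ U.dom, ∀ x y z w : M,
      (x, y) ∈ U.ent e → (y, z) ∈ U.ent e → (z, w) ∈ U.ent e → (x, w) ∈ U.ent c := by
  obtain ⟨d, hd, h⟩ := U.comp c hc
  obtain ⟨e, he, h'⟩ := U.comp d hd
  exact ⟨e, he, fun x y z w hxy hyz hzw =>
    h x z w (h' x y z hxy hyz) (h' z w w hzw (U.refl_mem_ent he w))⟩

/-- Finitely many distinct points can be separated by a single entourage. -/
theorem exists_ent_separating {ι : Type*} [Finite ι] {l : ℕ} (y : ι → Fin l → M)
    (hy : Function.Injective y) :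
    ∃ e ∈ U.dom, ∀ i j a b, a ∈ U.ballk e (y i) → b ∈ U.ballk e a → b ∈ U.ballk e (y j) →
      i = j := by
  have hpair : ∀ q : ι × ι, ∃ c ∈ U.dom, y q.2 ∈ U.ballk c (y q.1) → q.1 = q.2 := by
    rintro ⟨i, j⟩
    by_cases hij : i = j
    · obtain ⟨c, hc⟩ := U.dom_nonempty
      exact ⟨c, hc, fun _ => hij⟩
    · obtain ⟨t, ht⟩ := Function.ne_iff.1 (hy.ne hij)
      have hne := mt (U.inter_eq_diag (y i t) (y j t)).1 ht
      push Not at hne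
      obtain ⟨c, hc, hct⟩ := hne
      exact ⟨c, hc, fun h => absurd (h t) hct⟩
  choose c hc hsep using hpair
  obtain ⟨d, hd, hdc⟩ := U.exists_ent_subset_of_finite c hc
  obtain ⟨e, he, hed⟩ := U.exists_ent_comp_three hd
  exact ⟨e, he, fun i j a b ha hb hj => hsep (i, j) fun t =>
    hdc (i, j) (hed _ _ _ _ (ha t) (hb t) (U.symm_mem_ent he (hj t)))⟩

theorem isOpenk_interiork {k : ℕ} (A : Set (Fin k → M)) : U.IsOpenk (U.interiork A) := by
  rintro x ⟨c, hc, hcA⟩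
  obtain ⟨d, hd, h⟩ := U.comp c hc
  exact ⟨d, hd, fun y hy => ⟨d, hd, fun z hz => hcA fun i => h _ _ _ (hy i) (hz i)⟩⟩

theorem interiork_subset {k : ℕ} (A : Set (Fin k → M)) : U.interiork A ⊆ A := by
  rintro x ⟨c, hc, hcA⟩
  exact hcA fun i => U.refl_mem_ent hc (x i)

end DefUniformBasis

/-- Definable sets are stable under substituting variables and parameters for variables. -/
theorem DefSet.subst {α β : Type} {A : Set (α → M)} (hA : DefSet L M A) (t : α → β ⊕ M) :
    DefSet L M {v : β → M | (fun a => Sum.elim v id (t a)) ∈ A} := by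
  obtain ⟨φ, rfl⟩ := hA
  refine ⟨FirstOrder.Language.BoundedFormula.subst φ fun a => Sum.elim
    (fun b => FirstOrder.Language.Term.var b)
    (fun m => FirstOrder.Language.Constants.term
      (L.con (⟨m, Set.mem_univ m⟩ : (Set.univ : Set M)))) (t a), ?_⟩
  ext v
  simp only [Set.mem_ofPred_eq, FirstOrder.Language.Formula.Realize,
    FirstOrder.Language.BoundedFormula.realize_subst]
  refine iff_of_eq (congrArg (fun w => FirstOrder.Language.BoundedFormula.Realize φ w default) ?_)
  funext a
  rcases t a with b | m <;> simp

theorem DefSet.forall_finite {α ι : Type} [Finite ι] {A : ι → Set (α → M)}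
    (hA : ∀ i, DefSet L M (A i)) : DefSet L M {v : α → M | ∀ i, v ∈ A i} := by
  refine (congrArg (DefSet L M) ?_).mp (Set.definable_iInter_of_finite hA)
  ext v
  simp

namespace DefUniformBasis

variable (U : DefUniformBasis L M)

/-- The basic relation of the uniformity, with each variable replaced by a variable or a
parameter, is definable. -/
theorem defSet_ent {β : Type} (s t : β ⊕ M) (r : Fin U.n → β ⊕ M) :
    DefSet L M {v : β → M | (Sum.elim v id s, Sum.elim v id t) ∈
      U.ent (fun i => Sum.elim v id (r i))} := by
  have h := DefSet.subst U.phi_def (Sum.elim ![s, t] r)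
  refine (congrArg (DefSet L M) ?_).mp h
  ext v
  refine iff_of_eq (congrArg (· ∈ U.phi) ?_)
  funext a
  rcases a with a | a
  · fin_cases a <;> rfl
  · rfl

theorem defSet_ballk {k : ℕ} (c : Fin U.n → M) (x : Fin k → M) : DefSet L M (U.ballk c x) :=
  DefSet.forall_finite fun i =>
    U.defSet_ent (Sum.inr (x i)) (Sum.inl i) (fun j => Sum.inr (c j))

theorem defSet_interiork {k : ℕ} {A : Set (Fin k → M)} (hA : DefSet L M A) :
    DefSet L M (U.interiork A) := by
  have hball : DefSet L M {v : (Fin k ⊕ Fin U.n) ⊕ Fin k → M |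
      ∀ i : Fin k, (v (Sum.inl (Sum.inl i)), v (Sum.inr i)) ∈
        U.ent (fun j => v (Sum.inl (Sum.inr j)))} :=
    DefSet.forall_finite fun i => U.defSet_ent (Sum.inl (Sum.inl (Sum.inl i)))
      (Sum.inl (Sum.inr i)) (fun j => Sum.inl (Sum.inl (Sum.inr j)))
  have hnot : DefSet L M {v : (Fin k ⊕ Fin U.n) ⊕ Fin k → M | v ∘ Sum.inr ∈ A}ᶜ :=
    (Set.Definable.preimage_comp Sum.inr hA).compl
  have hall := (Set.Definable.exists_of_finite (Set.Definable.inter hball hnot)).compl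
  have hdom : DefSet L M {v : Fin k ⊕ Fin U.n → M | v ∘ Sum.inr ∈ U.dom} :=
    Set.Definable.preimage_comp Sum.inr U.dom_def
  refine (congrArg (DefSet L M) ?_).mp
    (Set.Definable.exists_of_finite (Set.Definable.inter hdom hall))
  ext x
  simp [interiork, ballk, Set.subset_def, Function.comp_def]

end DefUniformBasis

/-- A continuous `m`-correspondence on a definable open `U ⊆ M^k` locally splits
into `m` definable continuous functions with pairwise disjoint graphs. -/
theorem statement17 (S : Setting L M) {k l m : ℕ} (Uo : Set (Fin k → M))
    (hUdef : DefSet L M Uo) (hUopen : S.toDefUniformBasis.IsOpenk Uo)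
    (G : Set ((Fin k → M) × (Fin l → M))) (hG : IsMCorr L M Uo G m)
    (hGcont : S.toDefUniformBasis.CorrContOn Uo G) :
    ∀ p ∈ Uo, ∃ V : Set (Fin k → M), S.toDefUniformBasis.IsOpenk V ∧ p ∈ V ∧ V ⊆ Uo ∧
      ∃ g : Fin m → ((Fin k → M) → (Fin l → M)),
        (∀ i, DefRel L M {q : (Fin k → M) × (Fin l → M) | q.1 ∈ V ∧ q.2 = g i q.1}) ∧
        (∀ i, S.toDefUniformBasis.ContOn (g i) V) ∧
        (∀ i j, i ≠ j → ∀ x ∈ V, g i x ≠ g j x) ∧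
        (∀ x ∈ V, ∀ y, ((x, y) ∈ G ↔ ∃ i, g i x = y)) := by
  intro p hp
  have hne : Nonempty M := S.nonempty
  set U := S.toDefUniformBasis
  obtain ⟨⟨hGdef, -, hfib⟩, hcard⟩ := hG
  have : Finite {y | (p, y) ∈ G} := (hfib p hp).2
  let y : Fin m → Fin l → M := fun i => ((Finite.equivFinOfCardEq (hcard p hp)).symm i).1
  have hyG : ∀ i, (p, y i) ∈ G := fun i => ((Finite.equivFinOfCardEq (hcard p hp)).symm i).2
  have hyinj : Function.Injective y :=
    Subtype.val_injective.comp (Finite.equivFinOfCardEq (hcard p hp)).symm.injective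
  obtain ⟨c, hc, hsep⟩ := U.exists_ent_separating y hyinj
  obtain ⟨d, hd, hcont⟩ := hGcont p hp c hc
  let V := U.interiork (Uo ∩ U.ballk d p)
  have hVdef : DefSet L M V :=
    U.defSet_interiork (Set.Definable.inter hUdef (U.defSet_ballk d p))
  have hVsub : V ⊆ Uo ∩ U.ballk d p := U.interiork_subset _
  have hpV : p ∈ V := by
    obtain ⟨e, he, heU⟩ := hUopen p hp
    obtain ⟨e', he', h⟩ := U.exists_ent_subset_inter he hd
    exact ⟨e', he', fun z hz => ⟨heU fun i => (h (hz i)).1, fun i => (h (hz i)).2⟩⟩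
  have hex : ∀ i, ∀ x ∈ V, ∃ z, (x, z) ∈ G ∧ z ∈ U.ballk c (y i) := fun i x hx =>
    (hcont x (hVsub hx).1 (hVsub hx).2).1 (y i) (hyG i)
  choose! g hgG hgball using hex
  have hdisj : ∀ i j, ∀ x ∈ V, ∀ x' ∈ V, g j x' ∈ U.ballk c (g i x) → i = j :=
    fun i j x hx x' hx' h => hsep i j _ _ (hgball i x hx) h (hgball j x' hx')
  have hginj : ∀ x ∈ V, Function.Injective fun i => g i x := by
    intro x hx i j hij
    refine hdisj i j x hx x hx ?_
    rw [← show g i x = g j x from hij]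
    exact fun t => U.refl_mem_ent hc _
  have hcover : ∀ x ∈ V, ∀ z, (x, z) ∈ G → ∃ i, g i x = z := by
    intro x hx z hz
    have heq : Set.range (fun i => g i x) = {z | (x, z) ∈ G} := by
      refine Set.eq_of_subset_of_ncard_le ?_ ?_ (hfib x (hVsub hx).1).2
      · rintro _ ⟨i, rfl⟩
        exact hgG i x hx
      · rw [hcard x (hVsub hx).1, Set.ncard_range_of_injective (hginj x hx), Nat.card_fin]
    exact heq.ge hz
  refine ⟨V, U.isOpenk_interiork _, hpV, fun x hx => (hVsub hx).1, g, ?_, ?_, ?_, ?_⟩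
  · intro i
    have h1 : DefSet L M {v : Fin k ⊕ Fin l → M | v ∘ Sum.inl ∈ V} :=
      Set.Definable.preimage_comp Sum.inl hVdef
    have h2 : DefSet L M {v : Fin k ⊕ Fin l → M | v ∘ Sum.inr ∈ U.ballk c (y i)} :=
      Set.Definable.preimage_comp Sum.inr (U.defSet_ballk c (y i))
    refine (congrArg (DefSet L M) ?_).mp (Set.Definable.inter h1 (Set.Definable.inter hGdef h2))
    ext v
    constructor
    · rintro ⟨hv, hvG, hvb⟩
      refine ⟨hv, ?_⟩
      obtain ⟨j, hj⟩ := hcover _ hv _ hvG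
      obtain rfl : i = j := hsep i j _ _ hvb (fun t => U.refl_mem_ent hc _)
        (hj ▸ hgball j _ hv)
      exact hj.symm
    · rintro ⟨hv, hvg⟩
      simp only at hv hvg
      refine ⟨hv, ?_, ?_⟩
      · simpa [hvg] using hgG i _ hv
      · simpa [hvg] using hgball i _ hv
  · intro i x hx c' hc'
    obtain ⟨e, he, hec⟩ := U.exists_ent_subset_inter hc hc'
    obtain ⟨b, hb, hxb⟩ := hGcont x (hVsub hx).1 e he
    refine ⟨b, hb, fun x' hx' hx'b => ?_⟩
    obtain ⟨z, hz, hze⟩ := (hxb x' (hVsub hx').1 hx'b).1 _ (hgG i x hx)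
    obtain ⟨j, rfl⟩ := hcover x' hx' z hz
    obtain rfl := hdisj i j x hx x' hx' fun t => (hec (hze t)).1
    exact fun t => (hec (hze t)).2
  · exact fun i j hij x hx h => hij (hginj x hx h)
  · refine fun x hx z => ⟨hcover x hx z, ?_⟩
    rintro ⟨i, rfl⟩
    exact hgG i x hx

end DpTame
end
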